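/- Let A₁, A₂ ∈ M(2n,ℂ) be block-diagonal with upper-left (2n−2)×(2n−2) blocks B₁, B₂ and lower-right 2×2 blocks C₁, C₂ respectively. Let Q_{k,l}(X,Y) denote Q evaluated at k copies of X followed by l copies of Y (with Q_{k,l} = 0 when k < 0 or l < 0). Then Q_{k,l}(A₁,A₂) = k · Q_{k−1,l}(B₁,B₂) · Q(C₁) + l · Q_{k,l−1}(B₁,B₂) · Q(C₂) whenever k + l = n. -/

import Mathlib

open Matrix

/-- The function `Q` on `n` matrices of size `2n × 2n`. -/
noncomputable def Qgen (n : ℕ) (A : Fin n → Matrix (Fin (2*n)) (Fin (2*n)) ℂ) : ℂ :=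
  ∑ σ : Equiv.Perm (Fin (2*n)),
    ((Equiv.Perm.sign σ : ℤ) : ℂ) *
      ∏ i : Fin n,
        (A i (σ ⟨2*(i:ℕ), by have := i.isLt; omega⟩) (σ ⟨2*(i:ℕ)+1, by have := i.isLt; omega⟩)
          - A i (σ ⟨2*(i:ℕ)+1, by have := i.isLt; omega⟩) (σ ⟨2*(i:ℕ), by have := i.isLt; omega⟩))

/-- `Q_{k,l}(X,Y)`: `Q` evaluated at `k` copies of `X` followed by `l` copies of `Y`. -/
noncomputable def Qkl (k l : ℕ) (X Y : Matrix (Fin (2*(k+l))) (Fin (2*(k+l))) ℂ) : ℂ :=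
  Qgen (k+l) (fun i => if (i:ℕ) < k then X else Y)

/-- One summand of `Q`, with positions labelled by an equivalence `e`. -/
noncomputable def qterm {ι α : Type} [Fintype ι] [Fintype α] [DecidableEq α]
    (e : ι × Fin 2 ≃ α) (A : ι → Matrix α α ℂ) (σ : Equiv.Perm α) : ℂ :=
  ((Equiv.Perm.sign σ : ℤ) : ℂ) *
    ∏ i : ι, (A i (σ (e (i, 0))) (σ (e (i, 1))) - A i (σ (e (i, 1))) (σ (e (i, 0))))

/-- The labelling of positions used for block matrices. -/
def posEquiv (n : ℕ) : Fin (n + 1) × Fin 2 ≃ Fin (2 * n) ⊕ Fin 2 :=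
  (finProdFinEquiv.trans (finCongr (by ring : (n + 1) * 2 = 2 * n + 2))).trans
    finSumFinEquiv.symm

lemma posEquiv_castSucc (n : ℕ) (i : Fin n) (a : Fin 2) :
    posEquiv n (i.castSucc, a) = Sum.inl ⟨2 * (i : ℕ) + a, by omega⟩ := by
  unfold posEquiv
  simp only [Equiv.trans_apply]
  rw [Equiv.symm_apply_eq]
  ext
  simp
  omega

lemma posEquiv_last (n : ℕ) (a : Fin 2) :
    posEquiv n (Fin.last n, a) = Sum.inr a := by
  unfold posEquiv
  simp only [Equiv.trans_apply]
  rw [Equiv.symm_apply_eq]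
  ext
  simp
  omega

lemma Qgen_eq_qterm (n : ℕ) (A : Fin (n + 1) → Matrix (Fin (2 * n) ⊕ Fin 2) (Fin (2 * n) ⊕ Fin 2) ℂ)
    (h : 2 * n + 2 = 2 * (n + 1)) :
    Qgen (n + 1) (fun i => Matrix.reindex (finSumFinEquiv.trans (finCongr h))
      (finSumFinEquiv.trans (finCongr h)) (A i)) = ∑ σ, qterm (posEquiv n) A σ := by
  unfold Qgen
  set g := (finSumFinEquiv.trans (finCongr h) : Fin (2 * n) ⊕ Fin 2 ≃ Fin (2 * (n + 1))) with hg
  have key : ∀ (i : Fin (n + 1)) (a : Fin 2) (hh : 2 * (i : ℕ) + a < 2 * (n + 1)),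
      g.symm ⟨2 * (i : ℕ) + a, hh⟩ = posEquiv n (i, a) := by
    intro i a hh
    rw [Equiv.symm_apply_eq]
    ext
    simp [hg, posEquiv]
    omega
  rw [← Equiv.sum_comp g.permCongr]
  refine Finset.sum_congr rfl fun σ _ => ?_
  unfold qterm
  rw [Equiv.Perm.sign_permCongr]
  congr 1
  refine Finset.prod_congr rfl fun i _ => ?_
  have k0 := key i 0 (by have := i.isLt; simp; omega)
  have k1 := key i 1 (by have := i.isLt; simp; omega)
  simp only [Fin.val_zero, Fin.val_one, add_zero] at k0 k1
  simp only [Matrix.reindex_apply, Matrix.submatrix_apply, Equiv.permCongr_apply,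
    Equiv.symm_apply_apply, k0, k1]

/-- The permutation of the arguments moving `j` to the end. -/
def moveLast {n : ℕ} (j : Fin (n + 1)) : Equiv.Perm (Fin (n + 1)) :=
  finSuccEquivLast.trans (finSuccEquiv' j).symm

lemma moveLast_last {n : ℕ} (j : Fin (n + 1)) : moveLast j (Fin.last n) = j := by
  simp [moveLast]

lemma moveLast_castSucc {n : ℕ} (j : Fin (n + 1)) (i : Fin n) :
    moveLast j i.castSucc = j.succAbove i := by
  simp [moveLast]

lemma qterm_move {ι α : Type} [Fintype ι] [DecidableEq ι] [Fintype α] [DecidableEq α]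
    (e : ι × Fin 2 ≃ α) (A : ι → Matrix α α ℂ) (f : Equiv.Perm ι) (x : α) (j : ι) :
    (∑ σ : Equiv.Perm α, if (e.symm (σ⁻¹ x)).1 = f j then qterm e A σ else 0) =
    ∑ σ : Equiv.Perm α, if (e.symm (σ⁻¹ x)).1 = j then qterm e (fun i => A (f i)) σ else 0 := by
  set p : Equiv.Perm (ι × Fin 2) := Equiv.prodCongrLeft (fun _ : Fin 2 => f) with hp
  have hpa : ∀ i a, p (i, a) = (f i, a) := fun i a => rfl
  set π : Equiv.Perm α := e.permCongr p with hπ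
  have hsign : Equiv.Perm.sign π = 1 := by
    rw [hπ, Equiv.Perm.sign_permCongr, hp, Equiv.Perm.sign_prodCongrLeft]
    simp
  have hπe : ∀ i a, π (e (i, a)) = e (f i, a) := by
    intro i a
    simp [hπ, Equiv.permCongr_apply, hpa]
  have hπe' : ∀ i a, π⁻¹ (e (f i, a)) = e (i, a) := by
    intro i a
    rw [Equiv.Perm.inv_eq_iff_eq, hπe]
  rw [← Equiv.sum_comp (Equiv.mulRight π⁻¹)]
  refine Finset.sum_congr rfl fun σ _ => ?_
  have hc : (e.symm ((σ * π⁻¹)⁻¹ x)).1 = f (e.symm (σ⁻¹ x)).1 := by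
    obtain ⟨⟨i, a⟩, hi⟩ := e.surjective (σ⁻¹ x)
    rw [_root_.mul_inv_rev, inv_inv, Equiv.Perm.mul_apply, ← hi, hπe]
    simp
  have ht : qterm e A (σ * π⁻¹) = qterm e (fun i => A (f i)) σ := by
    unfold qterm
    rw [map_mul, Equiv.Perm.sign_inv, hsign, mul_one]
    congr 1
    rw [← Equiv.prod_comp f]
    simp only [Equiv.Perm.mul_apply, hπe']
  change (if (e.symm ((σ * π⁻¹)⁻¹ x)).1 = f j then qterm e A (σ * π⁻¹) else 0) = _
  rw [ht]
  refine if_congr ?_ rfl rfl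
  rw [hc, f.injective.eq_iff]

lemma Qgen_one (C : Matrix (Fin 2) (Fin 2) ℂ) :
    Qgen 1 (fun _ => C) = ∑ σ : Equiv.Perm (Fin 2), ((Equiv.Perm.sign σ : ℤ) : ℂ) *
      (C (σ 0) (σ 1) - C (σ 1) (σ 0)) := by
  unfold Qgen
  refine Finset.sum_congr rfl fun σ _ => ?_
  rw [Fin.prod_univ_one]
  rfl

lemma qterm_last (n : ℕ) (B : Fin (n + 1) → Matrix (Fin (2 * n)) (Fin (2 * n)) ℂ)
    (C : Fin (n + 1) → Matrix (Fin 2) (Fin 2) ℂ) :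
    (∑ σ, if ((posEquiv n).symm (σ⁻¹ (Sum.inr 0))).1 = Fin.last n then
      qterm (posEquiv n) (fun i => Matrix.fromBlocks (B i) 0 0 (C i)) σ else 0) =
    Qgen n (fun i => B i.castSucc) * Qgen 1 (fun _ => C (Fin.last n)) := by
  rw [Qgen_one]
  unfold Qgen
  rw [Finset.sum_mul_sum, ← Finset.sum_product', Finset.univ_product_univ]
  symm
  refine Finset.sum_of_injOn (fun σ => Equiv.Perm.sumCongrHom _ _ σ)
    (Equiv.Perm.sumCongrHom_injective.injOn) (by simp) ?_ ?_
  · intro σ _ hσ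
    rw [ite_eq_right_iff]
    intro hlast
    by_contra hne
    apply hσ
    have hfac : Matrix.fromBlocks (B (Fin.last n)) 0 0 (C (Fin.last n)) (σ (Sum.inr 0)) (σ (Sum.inr 1))
        - Matrix.fromBlocks (B (Fin.last n)) 0 0 (C (Fin.last n)) (σ (Sum.inr 1)) (σ (Sum.inr 0))
          ≠ 0 := by
      intro h0
      apply hne
      unfold qterm
      rw [Finset.prod_eq_zero (Finset.mem_univ (Fin.last n)), mul_zero]
      rw [posEquiv_last, posEquiv_last, h0]
    obtain ⟨a, ha⟩ : ∃ a : Fin 2, σ (Sum.inr a) = Sum.inr 0 := by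
      refine ⟨((posEquiv n).symm (σ⁻¹ (Sum.inr 0))).2, ?_⟩
      rw [← posEquiv_last, ← hlast]
      simp
    have hinj : σ (Sum.inr 0) ≠ σ (Sum.inr 1) := by
      intro h
      simpa using σ.injective h
    have hall : ∀ b : Fin 2, ∃ c : Fin 2, σ (Sum.inr c) = Sum.inr b := by
      rcases h0 : σ (Sum.inr 0) with x | x <;> rcases h1 : σ (Sum.inr 1) with y | y
      · fin_cases a <;> simp_all
      · simp [h0, h1] at hfac
      · simp [h0, h1] at hfac
      · rw [h0, h1] at hinj
        have hxy : x ≠ y := fun h => hinj (by rw [h])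
        intro b
        have : b = x ∨ b = y := by omega
        rcases this with rfl | rfl
        · exact ⟨0, h0⟩
        · exact ⟨1, h1⟩
    have hr : σ ∈ (Equiv.Perm.sumCongrHom (Fin (2 * n)) (Fin 2)).range := by
      apply Equiv.Perm.mem_sumCongrHom_range_of_perm_mapsTo_inl
      rintro _ ⟨x, rfl⟩
      rcases hx : σ (Sum.inl x) with y | y
      · exact ⟨y, rfl⟩
      · obtain ⟨c, hc⟩ := hall y
        have := σ.injective (hx.trans hc.symm)
        simp at this
    obtain ⟨τ, hτ⟩ := hr
    exact ⟨τ, by simp, hτ⟩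
  · rintro ⟨τ, ρ⟩ -
    have hs : ∀ x, Equiv.Perm.sumCongrHom (Fin (2 * n)) (Fin 2) (τ, ρ) x = Sum.map τ ρ x :=
      fun x => rfl
    have hinv : (Equiv.Perm.sumCongrHom (Fin (2 * n)) (Fin 2) (τ, ρ))⁻¹ (Sum.inr 0)
        = posEquiv n (Fin.last n, ρ⁻¹ 0) := by
      rw [Equiv.Perm.inv_eq_iff_eq, posEquiv_last, hs]
      simp
    have hsg : Equiv.Perm.sign (Equiv.Perm.sumCongrHom (Fin (2 * n)) (Fin 2) (τ, ρ))
        = Equiv.Perm.sign τ * Equiv.Perm.sign ρ := Equiv.Perm.sign_sumCongr τ ρ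
    simp only
    rw [hinv, Equiv.symm_apply_apply, if_pos rfl]
    unfold qterm
    rw [hsg, Fin.prod_univ_castSucc]
    simp only [hs, posEquiv_last, posEquiv_castSucc, Sum.map_inl, Sum.map_inr,
      Matrix.fromBlocks_apply₁₁, Matrix.fromBlocks_apply₂₂, Fin.val_zero, Fin.val_one, add_zero,
      Units.val_mul, Int.cast_mul]
    ring

lemma Qgen_block (n m : ℕ) (hm : m = n + 1) (h : 2 * n + 2 = 2 * m)
    (B : Fin m → Matrix (Fin (2 * n)) (Fin (2 * n)) ℂ)
    (C : Fin m → Matrix (Fin 2) (Fin 2) ℂ) :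
    Qgen m (fun i => Matrix.reindex (finSumFinEquiv.trans (finCongr h))
      (finSumFinEquiv.trans (finCongr h)) (Matrix.fromBlocks (B i) 0 0 (C i))) =
    ∑ j : Fin (n + 1), Qgen n (fun i => B (Fin.cast hm.symm (j.succAbove i))) *
      Qgen 1 (fun _ => C (Fin.cast hm.symm j)) := by
  subst hm
  rw [Qgen_eq_qterm]
  have h1 : ∀ σ : Equiv.Perm (Fin (2 * n) ⊕ Fin 2),
      qterm (posEquiv n) (fun i => Matrix.fromBlocks (B i) 0 0 (C i)) σ =
      ∑ j, if ((posEquiv n).symm (σ⁻¹ (Sum.inr 0))).1 = j then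
        qterm (posEquiv n) (fun i => Matrix.fromBlocks (B i) 0 0 (C i)) σ else 0 := by
    intro σ
    simp
  rw [Finset.sum_congr rfl fun σ _ => h1 σ, Finset.sum_comm]
  refine Finset.sum_congr rfl fun j _ => ?_
  have h2 := qterm_move (posEquiv n) (fun i => Matrix.fromBlocks (B i) 0 0 (C i))
    (moveLast j) (Sum.inr 0) (Fin.last n)
  rw [moveLast_last] at h2
  rw [h2, qterm_last n (fun i => B (moveLast j i)) (fun i => C (moveLast j i))]
  simp only [moveLast_last, moveLast_castSucc, Fin.cast_eq_self]

lemma Qgen_cast (n m : ℕ) (hm : n = m) (h : 2 * n = 2 * m)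
    (F : Fin n → Matrix (Fin (2 * n)) (Fin (2 * n)) ℂ) (G : Fin m → Matrix (Fin (2 * m)) (Fin (2 * m)) ℂ)
    (hG : ∀ i, G (Fin.cast hm i) = Matrix.reindex (finCongr h) (finCongr h) (F i)) :
    Qgen n F = Qgen m G := by
  subst hm
  congr 1
  funext i
  have := hG i
  simp only [Fin.cast_eq_self] at this
  rw [this]
  ext a b
  simp

/-- Corollary 7 of the paper: for block-diagonal `A₁, A₂` with blocks `Bᵢ` and `Cᵢ`,
`Q_{k,l}(A₁,A₂) = k Q_{k-1,l}(B₁,B₂) Q(C₁) + l Q_{k,l-1}(B₁,B₂) Q(C₂)`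
(with the convention that `Q_{k,l} = 0` when `k < 0` or `l < 0`). -/
theorem stmt4 (k l : ℕ) (hn : 1 ≤ k + l)
    (B₁ B₂ : Matrix (Fin (2*(k+l-1))) (Fin (2*(k+l-1))) ℂ)
    (C₁ C₂ : Matrix (Fin 2) (Fin 2) ℂ)
    (A₁ A₂ : Matrix (Fin (2*(k+l))) (Fin (2*(k+l))) ℂ)
    (hA₁ : A₁ = (Matrix.reindex
        (finSumFinEquiv.trans (finCongr (by omega : 2*(k+l-1) + 2 = 2*(k+l))))
        (finSumFinEquiv.trans (finCongr (by omega : 2*(k+l-1) + 2 = 2*(k+l)))))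
        (Matrix.fromBlocks B₁ 0 0 C₁))
    (hA₂ : A₂ = (Matrix.reindex
        (finSumFinEquiv.trans (finCongr (by omega : 2*(k+l-1) + 2 = 2*(k+l))))
        (finSumFinEquiv.trans (finCongr (by omega : 2*(k+l-1) + 2 = 2*(k+l)))))
        (Matrix.fromBlocks B₂ 0 0 C₂)) :
    Qkl k l A₁ A₂ =
      (if hk : 0 < k then
        (k : ℂ) * Qkl (k-1) l
          ((Matrix.reindex (finCongr (by omega : 2*(k+l-1) = 2*((k-1)+l)))
            (finCongr (by omega : 2*(k+l-1) = 2*((k-1)+l)))) B₁)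
          ((Matrix.reindex (finCongr (by omega : 2*(k+l-1) = 2*((k-1)+l)))
            (finCongr (by omega : 2*(k+l-1) = 2*((k-1)+l)))) B₂)
          * Qgen 1 (fun _ => C₁)
      else 0)
      +
      (if hl : 0 < l then
        (l : ℂ) * Qkl k (l-1)
          ((Matrix.reindex (finCongr (by omega : 2*(k+l-1) = 2*(k+(l-1))))
            (finCongr (by omega : 2*(k+l-1) = 2*(k+(l-1))))) B₁)
          ((Matrix.reindex (finCongr (by omega : 2*(k+l-1) = 2*(k+(l-1))))
            (finCongr (by omega : 2*(k+l-1) = 2*(k+(l-1))))) B₂)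
          * Qgen 1 (fun _ => C₂)
      else 0) := by
  have hM : Qkl k l A₁ A₂ = Qgen (k + l) (fun i => Matrix.reindex
      (finSumFinEquiv.trans (finCongr (by omega : 2*(k+l-1) + 2 = 2*(k+l))))
      (finSumFinEquiv.trans (finCongr (by omega : 2*(k+l-1) + 2 = 2*(k+l))))
      (Matrix.fromBlocks (if (i : ℕ) < k then B₁ else B₂) 0 0
        (if (i : ℕ) < k then C₁ else C₂))) := by
    unfold Qkl
    congr 1
    funext i
    split_ifs
    · exact hA₁
    · exact hA₂
  rw [hM, Qgen_block (k + l - 1) (k + l) (by omega) (by omega)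
    (fun i => if (i : ℕ) < k then B₁ else B₂) (fun i => if (i : ℕ) < k then C₁ else C₂)]
  set X : ℂ := if hk : 0 < k then
        Qkl (k-1) l
          ((Matrix.reindex (finCongr (by omega : 2*(k+l-1) = 2*((k-1)+l)))
            (finCongr (by omega : 2*(k+l-1) = 2*((k-1)+l)))) B₁)
          ((Matrix.reindex (finCongr (by omega : 2*(k+l-1) = 2*((k-1)+l)))
            (finCongr (by omega : 2*(k+l-1) = 2*((k-1)+l)))) B₂)
          * Qgen 1 (fun _ => C₁) else 0 with hX
  set Y : ℂ := if hl : 0 < l then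
        Qkl k (l-1)
          ((Matrix.reindex (finCongr (by omega : 2*(k+l-1) = 2*(k+(l-1))))
            (finCongr (by omega : 2*(k+l-1) = 2*(k+(l-1))))) B₁)
          ((Matrix.reindex (finCongr (by omega : 2*(k+l-1) = 2*(k+(l-1))))
            (finCongr (by omega : 2*(k+l-1) = 2*(k+(l-1))))) B₂)
          * Qgen 1 (fun _ => C₂) else 0 with hY
  have hterm : ∀ j : Fin (k + l - 1 + 1),
      Qgen (k + l - 1) (fun i => if ((j.succAbove i : Fin _) : ℕ) < k then B₁ else B₂) *
        Qgen 1 (fun _ => if (j : ℕ) < k then C₁ else C₂) = if (j : ℕ) < k then X else Y := by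
    intro j
    have hj := j.isLt
    by_cases hjk : (j : ℕ) < k
    · have hk : 0 < k := by omega
      simp only [hjk, if_true]
      rw [hX, dif_pos hk]
      congr 1
      refine Qgen_cast _ _ (by omega) (by omega) _ _ fun i => ?_
      have : ((j.succAbove i : Fin _) : ℕ) < k ↔ (i : ℕ) < k - 1 := by
        simp only [Fin.succAbove, Fin.lt_def, Fin.val_castSucc]
        split_ifs <;> simp <;> omega
      simp only [Fin.val_cast, this]
      split_ifs <;> rfl
    · have hl : 0 < l := by omega
      simp only [hjk, if_false]
      rw [hY, dif_pos hl]
      congr 1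
      refine Qgen_cast _ _ (by omega) (by omega) _ _ fun i => ?_
      have : ((j.succAbove i : Fin _) : ℕ) < k ↔ (i : ℕ) < k := by
        simp only [Fin.succAbove, Fin.lt_def, Fin.val_castSucc]
        split_ifs <;> simp <;> omega
      simp only [Fin.val_cast, this]
      split_ifs <;> rfl
  simp only [Fin.val_cast]
  rw [Finset.sum_congr rfl fun j _ => hterm j]
  rw [Fin.sum_univ_eq_sum_range (fun j => if j < k then X else Y),
    show k + l - 1 + 1 = k + l by omega, Finset.sum_range_add]
  have s1 : ∑ x ∈ Finset.range k, (if x < k then X else Y) = k * X := by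
    rw [Finset.sum_congr rfl (g := fun _ => X) fun x hx => if_pos (Finset.mem_range.mp hx)]
    simp
  have s2 : ∑ x ∈ Finset.range l, (if k + x < k then X else Y) = l * Y := by
    simp
  rw [s1, s2, hX, hY]
  split_ifs <;> ring
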